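/- Let r ≥ 1 and n ≥ 1 be integers, let a_1,…,a_r ≥ 2 be integers, and let q be a prime power with q ≡ 1 (mod a_i) for all i. Define σ_n := −1 if a_i divides n for every i with a_i even and Σ_{i : a_i even} n/a_i is odd, and σ_n := 1 otherwise. Then the minimum, over all r-tuples (t_1,…,t_r) of elements of GL_n(F_q) satisfying t_i^{a_i} = 1 for all i and det(t_1)⋯det(t_r) = 1, of Σ_{i=1}^r Σ_{j ∈ ℤ/a_iℤ} m_j(t_i)², equals 1 − σ_n + Σ_{i=1}^r ( n²/a_i + a_i·{n/a_i}·{−n/a_i} ), where {x} denotes the fractional part of x. -/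

import Mathlib

open scoped MatrixGroups Classical

/-- The multiplicity `m_j(t)` of `ζ^j` as an eigenvalue of `t` (over the algebraic
closure), namely the multiplicity of `ζ^j` as a root of the characteristic
polynomial of `t`. -/
noncomputable def eigMult {F : Type} [Field F] {n : ℕ} (a : ℕ)
    (ζ : AlgebraicClosure F) (t : GL (Fin n) F) (i : ZMod a) : ℕ :=
  Polynomial.rootMultiplicity (ζ ^ i.val)
    (Matrix.charpoly ((t : Matrix (Fin n) (Fin n) F).map (algebraMap F (AlgebraicClosure F))))

section RootsOfUnity

variable {K : Type*} [Field K] {a : ℕ} [NeZero a] {ζ : K}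

theorem pow_val_injective (hζ : IsPrimitiveRoot ζ a) :
    Function.Injective fun j : ZMod a => ζ ^ j.val := fun i j h =>
  ZMod.val_injective a (hζ.pow_inj (ZMod.val_lt i) (ZMod.val_lt j) h)

theorem pow_val_add_one (hζ : IsPrimitiveRoot ζ a) (j : ZMod a) :
    ζ ^ (j + 1).val = ζ ^ j.val * ζ := by
  rw [← pow_succ, ← pow_mod_orderOf ζ (j.val + 1), ← hζ.eq_orderOf, ← ZMod.val_natCast]
  simp

theorem exists_pow_val_eq (hζ : IsPrimitiveRoot ζ a) {x : K} (hx : x ^ a = 1) :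
    ∃ j : ZMod a, ζ ^ j.val = x := by
  obtain ⟨i, hi, rfl⟩ := hζ.eq_pow_of_pow_eq_one hx
  exact ⟨(i : ZMod a), by rw [ZMod.val_natCast, Nat.mod_eq_of_lt hi]⟩

theorem prod_pow_val (ζ : K) : ∏ j : ZMod a, ζ ^ j.val = ζ ^ ∑ i ∈ Finset.range a, i := by
  obtain ⟨b, rfl⟩ := Nat.exists_eq_succ_of_ne_zero (NeZero.ne a)
  rw [Finset.prod_pow_eq_pow_sum]
  congr 1
  exact Fin.sum_univ_eq_sum_range (fun i => i) (b + 1)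

theorem prod_pow_val_of_odd (hζ : IsPrimitiveRoot ζ a) (ha : Odd a) :
    ∏ j : ZMod a, ζ ^ j.val = 1 := by
  obtain ⟨b, hb⟩ := ha
  have hs : ∑ i ∈ Finset.range a, i = a * b := by
    have := Finset.sum_range_id_mul_two a
    rw [show a - 1 = b * 2 by omega, ← mul_assoc] at this
    omega
  rw [prod_pow_val, hs, pow_mul, hζ.pow_eq_one, one_pow]

theorem neg_one_ne_one_of_even (hζ : IsPrimitiveRoot ζ a) (ha : Even a) :
    (-1 : K) ≠ 1 := by
  obtain ⟨b, hb⟩ := ha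
  have h2 : IsPrimitiveRoot (ζ ^ b) 2 := hζ.pow (NeZero.pos a) (by omega)
  rw [← h2.eq_neg_one_of_two_right]
  exact h2.ne_one (by norm_num)

theorem prod_pow_val_of_even (hζ : IsPrimitiveRoot ζ a) (ha : Even a) :
    ∏ j : ZMod a, ζ ^ j.val = -1 := by
  obtain ⟨b, hb⟩ := ha
  have h0 := NeZero.pos a
  have hs : ∑ i ∈ Finset.range a, i = b * (a - 1) := by
    have := Finset.sum_range_id_mul_two a
    rw [show a * (a - 1) = b * (a - 1) * 2 by rw [mul_right_comm]; congr 1; omega] at this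
    omega
  have h2 : IsPrimitiveRoot (ζ ^ b) 2 := hζ.pow h0 (by omega)
  rw [prod_pow_val, hs, pow_mul, h2.eq_neg_one_of_two_right, Odd.neg_one_pow]
  exact ⟨b - 1, by omega⟩

theorem exists_mem_add_one_notMem {S : Finset (ZMod a)} (hS : S.Nonempty)
    (hS' : S ≠ Finset.univ) : ∃ j ∈ S, j + 1 ∉ S := by
  by_contra! h
  obtain ⟨x, hx⟩ := hS
  have key : ∀ m : ℕ, x + m ∈ S := by
    intro m
    induction m with
    | zero => simpa using hx
    | succ m ih => simpa [add_assoc] using h _ ih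
  apply hS'
  ext y
  simpa using key (y - x).val

theorem exists_card_eq_prod_pow_val_eq (hζ : IsPrimitiveRoot ζ a) {s : ℕ} (hs : 0 < s)
    (hsa : s < a) {e : K} (he : e ^ a = 1) :
    ∃ S : Finset (ZMod a), S.card = s ∧ ∏ j ∈ S, ζ ^ j.val = e := by
  obtain ⟨T, -, hT⟩ := Finset.exists_subset_card_eq
    (s := (Finset.univ : Finset (ZMod a))) (n := s) (by simpa [ZMod.card] using hsa.le)
  have key : ∀ m : ℕ, ∃ S : Finset (ZMod a), S.card = s ∧
      ∏ j ∈ S, ζ ^ j.val = (∏ j ∈ T, ζ ^ j.val) * ζ ^ m := by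
    intro m
    induction m with
    | zero => exact ⟨T, hT, by simp⟩
    | succ m ih =>
      obtain ⟨S, hS, hp⟩ := ih
      obtain ⟨j, hj, hj'⟩ := exists_mem_add_one_notMem (S := S)
        (Finset.card_pos.mp (by omega)) (by
          rintro rfl
          simp [ZMod.card] at hS
          omega)
      have hj'' : j + 1 ∉ S.erase j := fun h => hj' (Finset.mem_of_mem_erase h)
      refine ⟨insert (j + 1) (S.erase j), ?_, ?_⟩
      · rw [Finset.card_insert_of_notMem hj'', Finset.card_erase_of_mem hj]
        omega
      · rw [Finset.prod_insert hj'', pow_val_add_one hζ, pow_succ, ← mul_assoc, ← hp,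
          ← Finset.mul_prod_erase S _ hj]
        ring
  have hp : (∏ j ∈ T, ζ ^ j.val) ^ a = 1 := by
    rw [← Finset.prod_pow]
    exact Finset.prod_eq_one fun j _ => by rw [pow_right_comm, hζ.pow_eq_one, one_pow]
  have hp0 : ∏ j ∈ T, ζ ^ j.val ≠ 0 := by
    intro h
    rw [h, zero_pow (NeZero.ne a)] at hp
    exact zero_ne_one hp
  obtain ⟨m, -, hm⟩ := hζ.eq_pow_of_pow_eq_one (ξ := e / ∏ j ∈ T, ζ ^ j.val)
    (by rw [div_pow, he, hp, div_one])
  obtain ⟨S, hS, hS'⟩ := key m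
  exact ⟨S, hS, by rw [hS', hm, mul_div_cancel₀ _ hp0]⟩

end RootsOfUnity

section Multiplicities

variable {a n : ℕ} [NeZero a]

/-- The amount by which the sum of squares of `f : ZMod a → ℕ` with sum `n` exceeds its
minimal possible value. -/
def excess (n : ℕ) (f : ZMod a → ℕ) : ℤ :=
  ∑ j, ((f j : ℤ) - (n / a : ℕ)) * ((f j : ℤ) - (n / a : ℕ) - 1)

theorem sq_div_add_fract_mul_fract (n : ℕ) :
    (n : ℝ) ^ 2 / a + a * Int.fract ((n : ℝ) / a) * Int.fract (-(n : ℝ) / a) =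
      (2 * (n / a : ℕ) + 1) * n - (n / a : ℕ) * ((n / a : ℕ) + 1) * a := by
  have ha : (a : ℝ) ≠ 0 := Nat.cast_ne_zero.mpr (NeZero.ne a)
  have hn : (n : ℝ) = a * (n / a : ℕ) + (n % a : ℕ) := by
    exact_mod_cast (Nat.div_add_mod n a).symm
  have h1 : Int.fract ((n : ℝ) / a) = (n % a : ℕ) / a :=
    Int.fract_div_natCast_eq_div_natCast_mod
  rw [neg_div]
  by_cases hs : n % a = 0
  · have h0 : Int.fract ((n : ℝ) / a) = 0 := by rw [h1, hs]; simp
    rw [hs] at hn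
    rw [h0, hn]
    field_simp
    push_cast
    ring
  · have h0 : Int.fract ((n : ℝ) / a) ≠ 0 := by
      rw [h1]
      exact div_ne_zero (Nat.cast_ne_zero.mpr hs) ha
    rw [Int.fract_neg h0, h1]
    generalize ((n / a : ℕ) : ℝ) = k at *
    generalize ((n % a : ℕ) : ℝ) = s at *
    rw [hn]
    field_simp
    ring

theorem sum_sq_eq_add_excess {f : ZMod a → ℕ} (hf : ∑ j, f j = n) :
    ∑ j, (f j : ℝ) ^ 2 = (n : ℝ) ^ 2 / a +
      a * Int.fract ((n : ℝ) / a) * Int.fract (-(n : ℝ) / a) + excess n f := by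
  rw [sq_div_add_fract_mul_fract, excess]
  have hf' : (n : ℝ) = ∑ j, (f j : ℝ) := by exact_mod_cast hf.symm
  have hc : (a : ℝ) = ∑ _j : ZMod a, (1 : ℝ) := by simp [ZMod.card]
  generalize n / a = k
  push_cast
  rw [hf', hc, Finset.mul_sum, Finset.mul_sum, ← Finset.sum_sub_distrib,
    ← Finset.sum_add_distrib]
  exact Finset.sum_congr rfl fun j _ => by ring

theorem mul_sub_one_nonneg (x : ℤ) : 0 ≤ x * (x - 1) := by
  rcases le_or_gt x 0 with h | h <;> nlinarith

theorem excess_nonneg (f : ZMod a → ℕ) : 0 ≤ excess n f :=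
  Finset.sum_nonneg fun _ _ => mul_sub_one_nonneg _

theorem even_excess (f : ZMod a → ℕ) : Even (excess n f) :=
  Finset.even_sum _ fun _ _ => Int.even_mul_pred_self _

theorem eq_div_of_excess_eq_zero {f : ZMod a → ℕ} (hf : ∑ j, f j = n) (ha : a ∣ n)
    (h : excess n f = 0) (j : ZMod a) : f j = n / a := by
  rw [excess, Finset.sum_eq_zero_iff_of_nonneg fun _ _ => mul_sub_one_nonneg _] at h
  have hle : ∀ j ∈ Finset.univ, n / a ≤ f j := fun j hj => by
    rcases mul_eq_zero.mp (h j hj) with h | h <;> omega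
  have hs : ∑ _j : ZMod a, n / a = ∑ j, f j := by
    rw [hf]
    simp [ZMod.card, Nat.mul_div_cancel' ha]
  exact ((Finset.sum_eq_sum_iff_of_le hle).mp hs j (Finset.mem_univ j)).symm

variable {K : Type*} [Field K] {ζ : K}

theorem exists_excess_eq_zero_of_not_dvd (hζ : IsPrimitiveRoot ζ a) (hn : ¬ a ∣ n) {e : K}
    (he : e ^ a = 1) :
    ∃ f : ZMod a → ℕ, ∑ j, f j = n ∧ excess n f = 0 ∧ ∏ j, (ζ ^ j.val) ^ f j = e := by
  set P : K := (∏ j : ZMod a, ζ ^ j.val) ^ (n / a) with hP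
  have hPa : P ^ a = 1 := by
    rw [hP, prod_pow_val, pow_right_comm, pow_right_comm ζ, hζ.pow_eq_one, one_pow, one_pow]
  have hP0 : P ≠ 0 := by
    intro h
    rw [h, zero_pow (NeZero.ne a)] at hPa
    exact zero_ne_one hPa
  obtain ⟨S, hS, hSe⟩ := exists_card_eq_prod_pow_val_eq hζ (s := n % a)
    (Nat.pos_of_ne_zero fun h => hn (Nat.dvd_of_mod_eq_zero h)) (Nat.mod_lt _ (NeZero.pos a))
    (e := e / P) (by rw [div_pow, he, hPa, div_one])
  refine ⟨fun j => n / a + if j ∈ S then 1 else 0, ?_, ?_, ?_⟩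
  · rw [Finset.sum_add_distrib]
    simp [ZMod.card, hS, Nat.div_add_mod]
  · refine Finset.sum_eq_zero fun j _ => ?_
    dsimp only
    split_ifs <;> simp
  · simp_rw [pow_add, Finset.prod_mul_distrib, Finset.prod_pow, ← hP]
    rw [← mul_div_cancel₀ e hP0, ← hSe]
    simp [pow_ite, Finset.prod_ite_mem]

theorem exists_excess_eq_zero_of_dvd (ζ : K) (hn : a ∣ n) :
    ∃ f : ZMod a → ℕ, ∑ j, f j = n ∧ excess n f = 0 ∧
      ∏ j, (ζ ^ j.val) ^ f j = (∏ j : ZMod a, ζ ^ j.val) ^ (n / a) :=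
  ⟨fun _ => n / a, by simp [ZMod.card, Nat.mul_div_cancel' hn], by simp [excess],
    Finset.prod_pow _ _ _⟩

theorem exists_excess_eq_two (hζ : IsPrimitiveRoot ζ a) (ha : Even a) (hn0 : 0 < n)
    (hn : a ∣ n) :
    ∃ f : ZMod a → ℕ, ∑ j, f j = n ∧ excess n f = 2 ∧
      ∏ j, (ζ ^ j.val) ^ f j = (-1) ^ (n / a + 1) := by
  obtain ⟨k, rfl⟩ := hn
  have ha0 := NeZero.pos a
  obtain ⟨k, rfl⟩ : ∃ l, k = l + 1 := Nat.exists_eq_succ_of_ne_zero (by rintro rfl; simp at hn0)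
  obtain ⟨y, hy⟩ := exists_pow_val_eq hζ (x := -1) ha.neg_one_pow
  have hy0 : (0 : ZMod a) ≠ y := by
    rintro rfl
    simp at hy
    exact neg_one_ne_one_of_even hζ ha hy.symm
  have hk : a * (k + 1) / a = k + 1 := Nat.mul_div_cancel_left _ ha0
  have hsplit : ∀ (M : Type _) [CommMonoid M] (g : ZMod a → M),
      ∏ j, g j = g 0 * (g y * ∏ j ∈ (Finset.univ.erase 0).erase y, g j) := fun M _ g => by
    rw [Finset.mul_prod_erase _ _ (by simp [hy0.symm]), Finset.mul_prod_erase _ _ (by simp)]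
  have hsplit' : ∀ (M : Type) [AddCommMonoid M] (g : ZMod a → M),
      ∑ j, g j = g 0 + (g y + ∑ j ∈ (Finset.univ.erase 0).erase y, g j) := fun M _ g => by
    rw [Finset.add_sum_erase _ _ (by simp [hy0.symm]), Finset.add_sum_erase _ _ (by simp)]
  let f : ZMod a → ℕ := fun j => if j = 0 then k else if j = y then k + 2 else k + 1
  have h0 : f 0 = k := if_pos rfl
  have h1 : f y = k + 2 := by simp [f, hy0.symm]
  have h2 : ∀ j ∈ (Finset.univ.erase 0).erase y, f j = k + 1 := by
    intro j hj
    simp only [Finset.mem_erase] at hj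
    simp [f, hj.1, hj.2.1]
  refine ⟨f, ?_, ?_, ?_⟩
  · have := hsplit' ℕ fun _ => k + 1
    rw [hsplit', h0, h1, Finset.sum_congr rfl h2]
    simp only [Finset.sum_const, Finset.card_univ, ZMod.card, smul_eq_mul] at this ⊢
    omega
  · rw [excess, hsplit', h0, h1, hk, Finset.sum_eq_zero]
    · push_cast
      ring
    · intro j hj
      rw [h2 j hj]
      simp
  · have := hsplit K fun j => (ζ ^ j.val) ^ (k + 1)
    rw [Finset.prod_pow, prod_pow_val_of_even hζ ha, hy] at this
    rw [hsplit, h0, h1, hy, Finset.prod_congr rfl fun j hj => by rw [h2 j hj], hk]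
    simp only [ZMod.val_zero, pow_zero, one_pow] at this ⊢
    linear_combination this

end Multiplicities

section Matrices

theorem charpoly_roots_pow_eq_one {K : Type*} [Field K] {n a : ℕ} {M : Matrix (Fin n) (Fin n) K}
    (hM : M ^ a = 1) {x : K} (hx : x ∈ M.charpoly.roots) : x ^ a = 1 := by
  have h1 : x ∈ spectrum K M :=
    Matrix.mem_spectrum_iff_isRoot_charpoly.mpr (Polynomial.isRoot_of_mem_roots hx)
  have h2 := spectrum.pow_mem_pow M a h1
  have : Nonempty (Fin n) := by
    by_contra h
    rw [not_nonempty_iff] at h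
    exact h1 (isUnit_of_subsingleton _)
  rwa [hM, spectrum.one_eq, Set.mem_singleton_iff] at h2

theorem map_pow_eq_one {F : Type} [Field F] {n a : ℕ}
    {t : GL (Fin n) F} (ht : t ^ a = 1) :
    ((t : Matrix (Fin n) (Fin n) F).map (algebraMap F (AlgebraicClosure F))) ^ a = 1 := by
  have h : (t : Matrix (Fin n) (Fin n) F) ^ a = 1 := by
    rw [← Units.val_pow_eq_pow_val, ht, Units.val_one]
  have := congrArg (algebraMap F (AlgebraicClosure F)).mapMatrix h
  rwa [map_pow, map_one] at this

variable {F : Type} [Field F] {n a : ℕ} [NeZero a] {ζ : AlgebraicClosure F}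

theorem sum_eigMult (hζ : IsPrimitiveRoot ζ a) {t : GL (Fin n) F} (ht : t ^ a = 1) :
    ∑ j, eigMult a ζ t j = n := by
  set M := (t : Matrix (Fin n) (Fin n) F).map (algebraMap F (AlgebraicClosure F)) with hM
  have h : ∀ x ∈ M.charpoly.roots,
      x ∈ Finset.univ.image fun j : ZMod a => ζ ^ j.val := fun x hx => by
    simpa using exists_pow_val_eq hζ (charpoly_roots_pow_eq_one (map_pow_eq_one ht) hx)
  have hs := Multiset.sum_count_eq_card h
  rw [Finset.sum_image fun _ _ _ _ h => pow_val_injective hζ h,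
    Polynomial.splits_iff_card_roots.mp (IsAlgClosed.splits _),
    Matrix.charpoly_natDegree_eq_dim, Fintype.card_fin] at hs
  simpa [eigMult] using hs

theorem det_eq_prod_eigMult (hζ : IsPrimitiveRoot ζ a) {t : GL (Fin n) F} (ht : t ^ a = 1) :
    algebraMap F (AlgebraicClosure F) (t : Matrix (Fin n) (Fin n) F).det =
      ∏ j : ZMod a, (ζ ^ j.val) ^ eigMult a ζ t j := by
  set M := (t : Matrix (Fin n) (Fin n) F).map (algebraMap F (AlgebraicClosure F)) with hM
  have h : M.charpoly.roots.toFinset ⊆ Finset.univ.image fun j : ZMod a => ζ ^ j.val := by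
    intro x hx
    rw [Multiset.mem_toFinset] at hx
    simpa using exists_pow_val_eq hζ (charpoly_roots_pow_eq_one (map_pow_eq_one ht) hx)
  have hs := Finset.prod_multiset_count_of_subset _ _ h
  rw [Finset.prod_image fun _ _ _ _ h => pow_val_injective hζ h,
    ← Matrix.det_eq_prod_roots_charpoly] at hs
  rw [RingHom.map_det, RingHom.mapMatrix_apply, ← hM, hs]
  simp [eigMult, hM]

theorem exists_algebraMap_eq_of_card_mod_eq_one [Fintype F] (hq : Fintype.card F % a = 1)
    (hζ : IsPrimitiveRoot ζ a) : ∃ z : F, algebraMap F (AlgebraicClosure F) z = ζ := by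
  obtain ⟨g, hg⟩ := IsCyclic.exists_ofOrder_eq_natCard (α := Fˣ)
  have hd : a ∣ orderOf g := by
    rw [hg, Nat.card_eq_fintype_card, Fintype.card_units]
    exact (Nat.modEq_iff_dvd' Fintype.card_pos).mp
      (by rw [Nat.ModEq, hq]; exact Nat.mod_eq_of_lt (by
        have := Nat.mod_lt (Fintype.card F) (NeZero.pos a); omega))
  obtain ⟨b, hb⟩ := hd
  have hprim : IsPrimitiveRoot (algebraMap F (AlgebraicClosure F) ((g ^ b : Fˣ) : F)) a :=
    ((((IsPrimitiveRoot.orderOf g).pow (orderOf_pos g) (by rw [hb, mul_comm])).map_of_injective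
      Units.val_injective (f := Units.coeHom F))).map_of_injective
        (algebraMap F (AlgebraicClosure F)).injective
  obtain ⟨i, -, hi⟩ := hprim.eq_pow_of_pow_eq_one hζ.pow_eq_one
  exact ⟨((g ^ b : Fˣ) : F) ^ i, by rw [map_pow, hi]⟩

theorem exists_eigMult_eq [Fintype F] (hq : Fintype.card F % a = 1)
    (hζ : IsPrimitiveRoot ζ a) {f : ZMod a → ℕ} (hf : ∑ j, f j = n) :
    ∃ t : GL (Fin n) F, t ^ a = 1 ∧ eigMult a ζ t = f := by
  obtain ⟨z, hz⟩ := exists_algebraMap_eq_of_card_mod_eq_one hq hζ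
  have hza : z ^ a = 1 := (algebraMap F (AlgebraicClosure F)).injective
    (by rw [map_pow, hz, hζ.pow_eq_one, map_one])
  let e : Fin n ≃ Σ j : ZMod a, Fin (f j) := Fintype.equivOfCardEq (by simp [hf])
  let D : Matrix (Fin n) (Fin n) F := Matrix.diagonal fun x => z ^ (e x).1.val
  have hD : D ^ a = 1 := by
    rw [Matrix.diagonal_pow, ← Matrix.diagonal_one]
    congr 1
    ext x
    simp [pow_right_comm, hza]
  refine ⟨Units.ofPowEqOne D a hD (NeZero.ne a), Units.pow_ofPowEqOne hD (NeZero.ne a), ?_⟩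
  ext j
  rw [eigMult, Units.val_ofPowEqOne, Matrix.diagonal_map (map_zero _), Matrix.charpoly_diagonal,
    ← Polynomial.count_roots]
  have hr : ∏ x : Fin n, (Polynomial.X - Polynomial.C ((algebraMap F (AlgebraicClosure F) ∘
      fun x => z ^ (e x).1.val) x)) =
      ((Finset.univ.val.map fun x => ζ ^ (e x).1.val).map fun y =>
        Polynomial.X - Polynomial.C y).prod := by
    simp only [Finset.prod, Multiset.map_map, Function.comp_def, map_pow, hz]
  simp only [Function.comp_apply] at hr
  rw [hr, Polynomial.roots_multiset_prod_X_sub_C,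
    Multiset.count_map]
  have hc : (Finset.univ.filter fun x => ζ ^ j.val = ζ ^ (e x).1.val).card = f j := by
    have : (Finset.univ.filter fun x => ζ ^ j.val = ζ ^ (e x).1.val) =
        (Finset.univ.filter fun x => (e x).1 = j) := by
      ext x
      simp only [Finset.mem_filter, Finset.mem_univ, true_and]
      exact ⟨fun h => (pow_val_injective hζ h).symm, fun h => by rw [h]⟩
    rw [this, ← Fintype.card_subtype]
    rw [Fintype.card_congr ((e.subtypeEquiv fun x => Iff.rfl).trans
      (Equiv.sigmaSubtype j))]
    simp
  exact hc

end Matrices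

section Families

variable {K : Type*} [Field K] {ι : Type*} [Fintype ι] {n : ℕ} {a : ι → ℕ} [∀ i, NeZero (a i)]
  {ζ : ι → K}

theorem two_le_sum_excess (hζ : ∀ i, IsPrimitiveRoot (ζ i) (a i)) {f : ∀ i, ZMod (a i) → ℕ}
    (hf : ∀ i, ∑ j, f i j = n) (hprod : ∏ i, ∏ j, (ζ i ^ j.val) ^ f i j = 1)
    (hdvd : ∀ i, Even (a i) → a i ∣ n)
    (hodd : Odd (∑ i ∈ Finset.univ.filter fun i => Even (a i), n / a i)) :
    2 ≤ ∑ i, excess n (f i) := by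
  by_contra! hlt
  have hev : Even (∑ i, excess n (f i)) := Finset.even_sum _ fun i _ => even_excess (f i)
  have hnn : ∀ i ∈ Finset.univ, 0 ≤ excess n (f i) := fun i _ => excess_nonneg (f i)
  have h0 : ∑ i, excess n (f i) = 0 := by
    have := Finset.sum_nonneg hnn
    obtain ⟨c, hc⟩ := hev
    omega
  have hz : ∀ i, excess n (f i) = 0 := fun i =>
    (Finset.sum_eq_zero_iff_of_nonneg hnn).mp h0 i (Finset.mem_univ i)
  set N := ∏ i ∈ Finset.univ.filter fun i => ¬ Even (a i), a i with hN
  have hNodd : Odd N := by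
    rw [hN]
    exact Finset.prod_induction _ Odd (fun _ _ => Odd.mul) odd_one fun i hi => by
      simpa using hi
  have heven : ∏ i ∈ Finset.univ.filter (fun i => Even (a i)), ∏ j, (ζ i ^ j.val) ^ f i j =
      -1 := by
    rw [← hodd.neg_one_pow (α := K), ← Finset.prod_pow_eq_pow_sum]
    refine Finset.prod_congr rfl fun i hi => ?_
    have hi' : Even (a i) := by simpa using hi
    simp_rw [eq_div_of_excess_eq_zero (hf i) (hdvd i hi') (hz i)]
    rw [Finset.prod_pow, prod_pow_val_of_even (hζ i) hi']
  have hoddN : (∏ i ∈ Finset.univ.filter (fun i => ¬ Even (a i)),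
      ∏ j, (ζ i ^ j.val) ^ f i j) ^ N = 1 := by
    rw [← Finset.prod_pow]
    refine Finset.prod_eq_one fun i hi => ?_
    obtain ⟨c, hc⟩ : a i ∣ N := Finset.dvd_prod_of_mem a hi
    rw [← Finset.prod_pow]
    refine Finset.prod_eq_one fun j _ => ?_
    rw [hc, ← pow_mul, ← pow_mul, show j.val * (f i j * (a i * c)) = a i * (j.val * f i j * c) by
      ring, pow_mul, (hζ i).pow_eq_one, one_pow]
  obtain ⟨i, hi⟩ : (Finset.univ.filter fun i => Even (a i)).Nonempty := by
    rw [Finset.nonempty_iff_ne_empty]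
    intro h
    simp [h] at hodd
  apply neg_one_ne_one_of_even (hζ i) (by simpa using hi)
  rw [← Finset.prod_filter_mul_prod_filter_not _ (fun i => Even (a i)), heven] at hprod
  have := congrArg (· ^ N) hprod
  simpa only [mul_pow, hoddN, hNodd.neg_one_pow, mul_one, one_pow] using this

theorem exists_sum_excess_eq (hζ : ∀ i, IsPrimitiveRoot (ζ i) (a i)) (hn : 0 < n) :
    ∃ f : ∀ i, ZMod (a i) → ℕ, (∀ i, ∑ j, f i j = n) ∧
      ∑ i, excess n (f i) = 1 - (if (∀ i, Even (a i) → a i ∣ n) ∧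
        Odd (∑ i ∈ Finset.univ.filter fun i => Even (a i), n / a i) then -1 else 1) ∧
      ∏ i, ∏ j, (ζ i ^ j.val) ^ f i j = 1 := by
  have hoddcase : ∀ i, ¬ Even (a i) → ∃ f : ZMod (a i) → ℕ, ∑ j, f j = n ∧
      excess n f = 0 ∧ ∏ j, (ζ i ^ j.val) ^ f j = 1 := by
    intro i hi
    by_cases hd : a i ∣ n
    · obtain ⟨f, h1, h2, h3⟩ := exists_excess_eq_zero_of_dvd (ζ i) hd
      exact ⟨f, h1, h2, by
        rw [h3, prod_pow_val_of_odd (hζ i) (Nat.not_even_iff_odd.mp hi), one_pow]⟩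
    · exact exists_excess_eq_zero_of_not_dvd (hζ i) hd (one_pow _)
  have hevencase : ∀ i, Even (a i) → a i ∣ n → ∃ f : ZMod (a i) → ℕ, ∑ j, f j = n ∧
      excess n f = 0 ∧ ∏ j, (ζ i ^ j.val) ^ f j = (-1) ^ (n / a i) := by
    intro i hi hd
    obtain ⟨f, h1, h2, h3⟩ := exists_excess_eq_zero_of_dvd (ζ i) hd
    exact ⟨f, h1, h2, by rw [h3, prod_pow_val_of_even (hζ i) hi]⟩
  suffices h : ∃ (d : ι → ℤ) (e : ι → K), (∀ i, ∃ f : ZMod (a i) → ℕ, ∑ j, f j = n ∧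
      excess n f = d i ∧ ∏ j, (ζ i ^ j.val) ^ f j = e i) ∧
      ∑ i, d i = 1 - (if (∀ i, Even (a i) → a i ∣ n) ∧
        Odd (∑ i ∈ Finset.univ.filter fun i => Even (a i), n / a i) then -1 else 1) ∧
      ∏ i, e i = 1 by
    obtain ⟨d, e, h, hd, he⟩ := h
    choose f h1 h2 h3 using h
    exact ⟨f, h1, by simp_rw [h2, hd], by simp_rw [h3, he]⟩
  by_cases hdvd : ∀ i, Even (a i) → a i ∣ n
  · have hprod : ∏ i, (if Even (a i) then (-1 : K) ^ (n / a i) else 1) =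
        (-1) ^ ∑ i ∈ Finset.univ.filter fun i => Even (a i), n / a i := by
      rw [← Finset.prod_filter, Finset.prod_pow_eq_pow_sum]
    by_cases hodd : Odd (∑ i ∈ Finset.univ.filter fun i => Even (a i), n / a i)
    · obtain ⟨i₀, hi₀⟩ : (Finset.univ.filter fun i => Even (a i)).Nonempty := by
        rw [Finset.nonempty_iff_ne_empty]
        intro h
        simp [h] at hodd
      have hi₀' : Even (a i₀) := by simpa using hi₀
      refine ⟨fun i => if i = i₀ then 2 else 0, fun i =>
        (if Even (a i) then (-1 : K) ^ (n / a i) else 1) * (if i = i₀ then -1 else 1),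
        fun i => ?_, ?_, ?_⟩
      · by_cases hi : i = i₀
        · subst hi
          simpa [hi₀', pow_succ] using exists_excess_eq_two (hζ i) hi₀' hn (hdvd i hi₀')
        · by_cases he : Even (a i)
          · simpa [hi, he] using hevencase i he (hdvd i he)
          · simpa [hi, he] using hoddcase i he
      · rw [if_pos ⟨hdvd, hodd⟩]
        simp
      · rw [Finset.prod_mul_distrib, hprod, hodd.neg_one_pow]
        simp
    · refine ⟨fun _ => 0, fun i => if Even (a i) then (-1 : K) ^ (n / a i) else 1,
        fun i => ?_, ?_, ?_⟩
      · by_cases he : Even (a i)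
        · simpa [he] using hevencase i he (hdvd i he)
        · simpa [he] using hoddcase i he
      · rw [if_neg fun h => hodd h.2]
        simp
      · rw [hprod, (Nat.not_odd_iff_even.mp hodd).neg_one_pow]
  · have hany : ∀ i, ∃ e : K, (e = 1 ∨ e = -1) ∧ ∃ f : ZMod (a i) → ℕ, ∑ j, f j = n ∧
        excess n f = 0 ∧ ∏ j, (ζ i ^ j.val) ^ f j = e := by
      intro i
      by_cases he : Even (a i)
      · by_cases hd : a i ∣ n
        · exact ⟨_, neg_one_pow_eq_or K _, hevencase i he hd⟩
        · exact ⟨1, Or.inl rfl, exists_excess_eq_zero_of_not_dvd (hζ i) hd (one_pow _)⟩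
      · exact ⟨1, Or.inl rfl, hoddcase i he⟩
    choose e he hfe using hany
    push Not at hdvd
    obtain ⟨i₀, hi₀, hd₀⟩ := hdvd
    have hP : (∏ i ∈ Finset.univ.erase i₀, e i) ^ 2 = 1 := by
      rw [← Finset.prod_pow]
      exact Finset.prod_eq_one fun i _ => by rcases he i with h | h <;> simp [h]
    refine ⟨fun _ => 0, fun i => if i = i₀ then ∏ i ∈ Finset.univ.erase i₀, e i else e i,
      fun i => ?_, ?_, ?_⟩
    · by_cases hi : i = i₀
      · subst hi
        obtain ⟨b, hb⟩ := hi₀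
        simpa using exists_excess_eq_zero_of_not_dvd (hζ i) hd₀
          (e := ∏ i ∈ Finset.univ.erase i, e i) (by rw [hb, ← two_mul, pow_mul, hP, one_pow])
      · simpa [hi] using hfe i
    · rw [if_neg fun h => hd₀ (h.1 i₀ hi₀)]
      simp
    · rw [← Finset.mul_prod_erase _ _ (Finset.mem_univ i₀), if_pos rfl,
        Finset.prod_congr rfl fun i hi => if_neg (Finset.ne_of_mem_erase hi), ← sq, hP]

end Families

theorem stmt_18 (r n q : ℕ) (hr : 1 ≤ r) (hn : 1 ≤ n)
    (a : Fin r → ℕ) (ha : ∀ i, 2 ≤ a i) (hq : IsPrimePow q)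
    (hqa : ∀ i, q % a i = 1)
    (F : Type) [Field F] [Fintype F] (hF : Fintype.card F = q)
    (ζ : Fin r → AlgebraicClosure F) (hζ : ∀ i, IsPrimitiveRoot (ζ i) (a i)) :
    IsLeast
      {d : ℝ | ∃ t : Fin r → GL (Fin n) F,
        (∀ i, t i ^ a i = 1) ∧
        (∏ i, ((t i : Matrix (Fin n) (Fin n) F).det)) = 1 ∧
        d = ∑ i, ∑ᶠ j : ZMod (a i), (eigMult (a i) (ζ i) (t i) j : ℝ) ^ 2}
      (1 -
        (if (∀ i, Even (a i) → a i ∣ n) ∧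
            Odd (∑ i ∈ Finset.univ.filter fun i => Even (a i), n / a i)
          then (-1 : ℝ) else 1) +
        ∑ i, ((n : ℝ) ^ 2 / (a i : ℝ) +
          (a i : ℝ) * Int.fract ((n : ℝ) / (a i : ℝ)) * Int.fract (-(n : ℝ) / (a i : ℝ)))) := by
  have hne : ∀ i, NeZero (a i) := fun i => ⟨by have := ha i; omega⟩
  have hsum : ∀ t : Fin r → GL (Fin n) F, (∀ i, t i ^ a i = 1) →
      ∑ i, ∑ᶠ j : ZMod (a i), (eigMult (a i) (ζ i) (t i) j : ℝ) ^ 2 =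
        ((∑ i, excess n (eigMult (a i) (ζ i) (t i)) : ℤ) : ℝ) +
        ∑ i, ((n : ℝ) ^ 2 / (a i : ℝ) +
          (a i : ℝ) * Int.fract ((n : ℝ) / (a i : ℝ)) * Int.fract (-(n : ℝ) / (a i : ℝ))) := by
    intro t ht
    rw [Int.cast_sum, ← Finset.sum_add_distrib]
    refine Finset.sum_congr rfl fun i _ => ?_
    rw [finsum_eq_sum_of_fintype, sum_sq_eq_add_excess (sum_eigMult (hζ i) (ht i)), add_comm]
  have hdet : ∀ t : Fin r → GL (Fin n) F, (∀ i, t i ^ a i = 1) →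
      algebraMap F (AlgebraicClosure F) (∏ i, (t i : Matrix (Fin n) (Fin n) F).det) =
        ∏ i, ∏ j : ZMod (a i), (ζ i ^ j.val) ^ eigMult (a i) (ζ i) (t i) j := by
    intro t ht
    rw [map_prod]
    exact Finset.prod_congr rfl fun i _ => det_eq_prod_eigMult (hζ i) (ht i)
  constructor
  · obtain ⟨f, hf, hex, hprod⟩ := exists_sum_excess_eq hζ hn
    choose t ht htf using fun i => exists_eigMult_eq (hF ▸ hqa i) (hζ i) (hf i)
    refine ⟨t, ht, ?_, ?_⟩
    · apply (algebraMap F (AlgebraicClosure F)).injective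
      rw [hdet t ht, map_one, ← hprod]
      simp_rw [htf]
    · rw [hsum t ht]
      simp_rw [htf]
      rw [hex]
      push_cast
      rfl
  · rintro d ⟨t, ht, htdet, rfl⟩
    rw [hsum t ht]
    gcongr
    have hprod := hdet t ht
    rw [htdet, map_one] at hprod
    split_ifs with h
    · have := two_le_sum_excess hζ (fun i => sum_eigMult (hζ i) (ht i)) hprod.symm h.1 h.2
      have : (2 : ℝ) ≤ ((∑ i, excess n (eigMult (a i) (ζ i) (t i)) : ℤ) : ℝ) := by
        exact_mod_cast this
      linarith
    · rw [sub_self]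
      exact_mod_cast Finset.sum_nonneg fun i _ => excess_nonneg (n := n) _
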